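/- arXiv:2110.02550 — 3 statements merged into one kernel-verified Lean document; each statement's English description precedes it below -/
import Mathlib

section
/- Let n ≥ 2, let q₁ < q₂ < ⋯ < q_n be real quantization levels with Q = {q₁, …, q_n}, and let mᵢ = (qᵢ + q_{i+1})/2 for 1 ≤ i ≤ n−1. Define the partial constraint functions y₀(w) = −2(w − q₁) if w < q₁ and 0 otherwise; yᵢ(w) = −2|w − mᵢ| + (q_{i+1} − qᵢ) if qᵢ ≤ w < q_{i+1} and 0 otherwise (1 ≤ i ≤ n−1); y_n(w) = 2(w − q_n) if w ≥ q_n and 0 otherwise; and Y(w) = Σ_{i=0}^{n} yᵢ(w). Then for every w ∈ ℝ, Y(w) = 2·dist(w, Q), where dist(w, Q) = min_{1 ≤ i ≤ n} |w − qᵢ|. -/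
theorem stmt_5_aux (q : ℕ → ℝ) (w : ℝ) (m : ℕ) :
    (∀ i, i < m → q i < q (i + 1)) →
    ((if w < q 0 then -2 * (w - q 0) else 0)
      + (∑ i ∈ Finset.range m,
          if q i ≤ w ∧ w < q (i + 1) then
            -2 * |w - (q i + q (i + 1)) / 2| + (q (i + 1) - q i)
          else 0)
      + (if q m ≤ w then 2 * (w - q m) else 0))
      = 2 * (Finset.range (m + 1)).inf' Finset.nonempty_range_add_one (fun i => |w - q i|)
    ∧ (q m ≤ w → (Finset.range (m + 1)).inf' Finset.nonempty_range_add_one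
        (fun i => |w - q i|) = w - q m) := by
  induction m with
  | zero =>
    intro _
    simp only [Finset.range_zero, Finset.sum_empty, zero_add, Finset.range_one,
      Finset.inf'_singleton]
    refine ⟨?_, fun h => abs_of_nonneg (by linarith)⟩
    rcases lt_or_ge w (q 0) with h | h
    · rw [if_pos h, if_neg (not_le.mpr h), abs_of_neg (by linarith)]; ring
    · rw [if_neg (not_lt.mpr h), if_pos h, abs_of_nonneg (by linarith)]; ring
  | succ m ih =>
    intro hq
    obtain ⟨h1, h2⟩ := ih (fun i hi => hq i (by omega))
    have hm := hq m (by omega)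
    have hle : (Finset.range (m + 1)).inf' Finset.nonempty_range_add_one
        (fun i => |w - q i|) ≤ |w - q m| :=
      Finset.inf'_le (fun i => |w - q i|) (Finset.mem_range.mpr (Nat.lt_succ_self m))
    have hs : (Finset.range (m + 1 + 1)).inf' Finset.nonempty_range_add_one
        (fun i => |w - q i|) = min |w - q (m + 1)| ((Finset.range (m + 1)).inf'
          Finset.nonempty_range_add_one (fun i => |w - q i|)) := by
      simp only [Finset.range_add_one (n := m + 1)]
      rw [Finset.inf'_insert]
    rw [hs, Finset.sum_range_succ]
    generalize (Finset.range (m + 1)).inf' Finset.nonempty_range_add_one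
        (fun i => |w - q i|) = I at *
    generalize (∑ i ∈ Finset.range m, _ : ℝ) = S at *
    generalize (if w < q 0 then -2 * (w - q 0) else 0 : ℝ) = A at *
    rcases lt_or_ge w (q m) with h | h
    · have h' : w < q (m + 1) := h.trans hm
      rw [if_neg (not_le.mpr h)] at h1
      rw [abs_of_neg (by linarith)] at hle
      rw [if_neg (fun hh => not_le.mpr h hh.1), if_neg (not_le.mpr h'),
        abs_of_neg (by linarith), min_eq_right (by linarith)]
      exact ⟨by linarith, fun hh => by linarith⟩
    · have hI := h2 h
      rw [if_pos h] at h1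
      subst hI
      rcases lt_or_ge w (q (m + 1)) with h' | h'
      · rw [if_pos ⟨h, h'⟩, if_neg (not_le.mpr h'), abs_of_neg (a := w - q (m + 1)) (by linarith)]
        refine ⟨?_, fun hh => by linarith⟩
        rcases le_total w ((q m + q (m + 1)) / 2) with h3 | h3
        · rw [abs_of_nonpos (by linarith), min_eq_right (by linarith)]; linarith
        · rw [abs_of_nonneg (by linarith), min_eq_left (by linarith)]; linarith
      · rw [if_neg (fun hh => not_lt.mpr h' hh.2), if_pos h',
          abs_of_nonneg (by linarith), min_eq_left (by linarith)]
        exact ⟨by linarith, fun _ => rfl⟩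

/-- The sum `Y` of the sawtooth partial constraint functions `y₀, …, y_n` of Eq. (8)
(here with quantization levels `q 0 < q 1 < ⋯ < q (n-1)`, i.e. 0-indexed, and
midpoints `(q i + q (i+1)) / 2`) equals twice the distance to the set of
quantization levels: `Y w = 2 * min_i |w - q i|`. -/
theorem stmt_5 (n : ℕ) (hn : 2 ≤ n) (q : ℕ → ℝ)
    (hq : ∀ i, i + 1 < n → q i < q (i + 1)) (w : ℝ) :
    ((if w < q 0 then -2 * (w - q 0) else 0)
      + (∑ i ∈ Finset.range (n - 1),
          if q i ≤ w ∧ w < q (i + 1) then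
            -2 * |w - (q i + q (i + 1)) / 2| + (q (i + 1) - q i)
          else 0)
      + (if q (n - 1) ≤ w then 2 * (w - q (n - 1)) else 0))
      = 2 * (Finset.range n).inf' (Finset.nonempty_range_iff.mpr (by omega))
          (fun i => |w - q i|) := by
  obtain ⟨m, rfl⟩ : ∃ m, n = m + 1 := ⟨n - 1, by omega⟩
  exact (stmt_5_aux q w m (fun i hi => hq i (by omega))).1
end

section
/- Let n ≥ 2, q₁ < ⋯ < q_n real quantization levels with Q = {q₁, …, q_n}, midpoints mᵢ = (qᵢ + q_{i+1})/2, partial constraint functions y₀, …, y_n as in Eq. (8), and Y(w) = Σ_{i=0}^{n} yᵢ(w). Then Y(w) ≥ 0 for all w ∈ ℝ, and Y(w) = 0 if and only if w ∈ Q. Consequently, for weights w₁, …, w_N, the constraint-failure score CFS = (1/N)·Σ_{j=1}^{N} Y(w_j) satisfies CFS = 0 if and only if every weight w_j lies in Q. -/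
/-- The sawtooth constraint sum `Y` (Eq. (8), quantization levels `q 0 < ⋯ < q (n-1)`,
0-indexed) is nonnegative and vanishes exactly on the set of quantization levels;
consequently the constraint-failure score `CFS = (1/N) ∑ⱼ Y (w j)` vanishes iff
every weight is a quantization level. -/
theorem stmt_6 (n : ℕ) (hn : 2 ≤ n) (q : ℕ → ℝ)
    (hq : ∀ i, i + 1 < n → q i < q (i + 1))
    (Y : ℝ → ℝ)
    (hY : ∀ w, Y w =
      (if w < q 0 then -2 * (w - q 0) else 0)
      + (∑ i ∈ Finset.range (n - 1),
          if q i ≤ w ∧ w < q (i + 1) then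
            -2 * |w - (q i + q (i + 1)) / 2| + (q (i + 1) - q i)
          else 0)
      + (if q (n - 1) ≤ w then 2 * (w - q (n - 1)) else 0)) :
    (∀ w, 0 ≤ Y w) ∧
    (∀ w, Y w = 0 ↔ ∃ i < n, w = q i) ∧
    (∀ (N : ℕ), 1 ≤ N → ∀ ws : Fin N → ℝ,
      ((1 / (N : ℝ)) * ∑ j, Y (ws j) = 0 ↔ ∀ j, ∃ i < n, ws j = q i)) := by
  have mono : ∀ a b, a ≤ b → b < n → q a ≤ q b := by
    intro a b hab
    induction b, hab using Nat.le_induction with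
    | base => intro _; exact le_refl _
    | succ b hab ih => intro hb; exact (ih (by omega)).trans (hq b hb).le
  have h1 : ∀ w, 0 ≤ (if w < q 0 then -2 * (w - q 0) else 0) := by
    intro w
    split_ifs with h <;> linarith
  have h2 : ∀ w, ∀ i ∈ Finset.range (n - 1), 0 ≤ (if q i ≤ w ∧ w < q (i + 1) then
            -2 * |w - (q i + q (i + 1)) / 2| + (q (i + 1) - q i)
          else 0) := by
    intro w i _
    split_ifs with h
    · have : |w - (q i + q (i + 1)) / 2| ≤ (q (i + 1) - q i) / 2 := by
        rw [abs_le]; constructor <;> linarith [h.1, h.2]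
      linarith
    · exact le_refl _
  have h3 : ∀ w, 0 ≤ (if q (n - 1) ≤ w then 2 * (w - q (n - 1)) else 0) := by
    intro w
    split_ifs with h <;> linarith
  have hnn : ∀ w, 0 ≤ Y w := by
    intro w
    rw [hY]
    have := Finset.sum_nonneg (h2 w)
    linarith [h1 w, h3 w]
  have hz : ∀ w, Y w = 0 ↔ ∃ i < n, w = q i := by
    intro w
    constructor
    · intro h0
      rw [hY] at h0
      have hs := Finset.sum_nonneg (h2 w)
      have e1 := le_antisymm (by linarith [h1 w, h3 w]) (h1 w)
      have e3 := le_antisymm (by linarith [h1 w, h3 w]) (h3 w)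
      have e2 := (Finset.sum_eq_zero_iff_of_nonneg (h2 w)).1
        (le_antisymm (by linarith [h1 w, h3 w]) hs)
      have hw0 : q 0 ≤ w := by
        by_contra hc
        push Not at hc
        rw [if_pos hc] at e1
        linarith
      by_cases hl : q (n - 1) ≤ w
      · rw [if_pos hl] at e3
        exact ⟨n - 1, by omega, by linarith⟩
      · have key : ∀ k, k ≤ n - 1 → w < q k → ∃ i, i < n - 1 ∧ q i ≤ w ∧ w < q (i + 1) := by
          intro k
          induction k with
          | zero => intro _ h; linarith
          | succ k ih =>
            intro hk h
            by_cases hc : q k ≤ w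
            · exact ⟨k, by omega, hc, h⟩
            · exact ih (by omega) (not_le.1 hc)
        obtain ⟨i, hi, ha⟩ := key (n - 1) le_rfl (not_le.1 hl)
        have e := e2 i (Finset.mem_range.2 hi)
        rw [if_pos ha] at e
        rcases abs_cases (w - (q i + q (i + 1)) / 2) with ⟨h, _⟩ | ⟨h, _⟩
        · exact ⟨i + 1, by omega, by linarith⟩
        · exact ⟨i, by omega, by linarith⟩
    · rintro ⟨k, hk, rfl⟩
      rw [hY, if_neg (not_lt.2 (mono 0 k (by omega) hk)), Finset.sum_eq_zero]
      · have := mono k (n - 1) (by omega) (by omega)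
        split_ifs <;> linarith
      · intro i hi
        have hi := Finset.mem_range.1 hi
        split_ifs with h
        · have hki : k ≤ i := by
            by_contra hc
            have := mono (i + 1) k (by omega) hk
            linarith [h.2]
          have := mono k i hki (by omega)
          have e : q k = q i := le_antisymm this h.1
          rw [e, abs_of_nonpos (by linarith [hq i (by omega)])]
          ring
        · rfl
  refine ⟨hnn, hz, ?_⟩
  intro N hN ws
  have hN' : (1 / (N : ℝ)) ≠ 0 := by
    have : (0 : ℝ) < N := by exact_mod_cast hN
    positivity
  rw [mul_eq_zero, or_iff_right hN', Finset.sum_eq_zero_iff_of_nonneg (fun j _ => hnn _)]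
  simp [hz]
end

section
/- Let C : ℝ^N → ℝ be differentiable, let Y₁, …, Y_N : ℝ → ℝ and u₁, …, u_N : ℝ → ℝ be functions such that each gated constraint csᵢ(w) = uᵢ(w)·Yᵢ(w), and let (W(t), λ(t)) be differentiable curves with dwᵢ/dt = −(1/τ_W)·(∂C/∂wᵢ + λᵢ·(d/dw)[uᵢYᵢ](wᵢ)) and dλᵢ/dt = (1/τ_λ)·uᵢ(wᵢ)Yᵢ(wᵢ). Fix a time t at which, for each i, uᵢ is locally constant near wᵢ(t) with value 0 or 1, and Yᵢ is differentiable at wᵢ(t). Let D = {i : uᵢ(wᵢ(t)) = 0} (weights inside the unconstrained-weight window). Then (d/dt) 𝓛(W(t), λ(t)) = −(1/τ_W)·Σ_{i ∈ D} (∂C/∂wᵢ)² − Σ_{i ∉ D} [ (1/τ_W)·(∂C/∂wᵢ + λᵢ·Yᵢ′(wᵢ))² − (1/τ_λ)·Yᵢ(wᵢ)² ], where 𝓛(W, λ) = C(W) + Σᵢ λᵢ·uᵢ(wᵢ)Yᵢ(wᵢ). -/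
open Classical in
/-- BDMM Lyapunov identity with the gated constraints `csᵢ(w) = uᵢ(w) · Yᵢ(w)`:
at a time `t` where each window function `uᵢ` is locally constant near `wᵢ(t)` with
value `0` or `1` and each `Yᵢ` is differentiable at `wᵢ(t)`, letting
`D = {i : uᵢ(wᵢ(t)) = 0}` (weights inside the unconstrained-weight window),
`d𝓛/dt = -(1/τ_W) ∑_{i ∈ D} (∂C/∂wᵢ)²
         - ∑_{i ∉ D} [(1/τ_W)(∂C/∂wᵢ + λᵢ Yᵢ'(wᵢ))² - (1/τ_λ) Yᵢ(wᵢ)²]`,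
where `𝓛(W, λ) = C W + ∑ᵢ λᵢ uᵢ(wᵢ) Yᵢ(wᵢ)`. -/
theorem stmt_18 (N : ℕ) (τW τΛ : ℝ) (hτW : 0 < τW) (hτΛ : 0 < τΛ)
    (C : (Fin N → ℝ) → ℝ) (hC : Differentiable ℝ C)
    (Y u : Fin N → ℝ → ℝ)
    (W lam : ℝ → Fin N → ℝ)
    (hW : ∀ s i, HasDerivAt (fun r => W r i)
      (-(1 / τW) * (fderiv ℝ C (W s) (Pi.single i 1)
        + lam s i * deriv (fun x => u i x * Y i x) (W s i))) s)
    (hlam : ∀ s i, HasDerivAt (fun r => lam r i)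
      ((1 / τΛ) * (u i (W s i) * Y i (W s i))) s)
    (t : ℝ)
    (hloc : ∀ i, ∀ᶠ x in nhds (W t i), u i x = u i (W t i))
    (hval : ∀ i, u i (W t i) = 0 ∨ u i (W t i) = 1)
    (hYdiff : ∀ i, DifferentiableAt ℝ (Y i) (W t i)) :
    HasDerivAt (fun s => C (W s) + ∑ i, lam s i * (u i (W s i) * Y i (W s i)))
      (-(1 / τW) * (∑ i ∈ Finset.univ.filter (fun i => u i (W t i) = 0),
          (fderiv ℝ C (W t) (Pi.single i 1)) ^ 2)
        - ∑ i ∈ (Finset.univ.filter (fun i => u i (W t i) = 0))ᶜ,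
          ((1 / τW) * (fderiv ℝ C (W t) (Pi.single i 1)
              + lam t i * deriv (Y i) (W t i)) ^ 2
            - (1 / τΛ) * (Y i (W t i)) ^ 2)) t := by
  have hg : ∀ i, HasDerivAt (fun x => u i x * Y i x) (u i (W t i) * deriv (Y i) (W t i)) (W t i) := by
    intro i
    refine ((hYdiff i).hasDerivAt.const_mul (u i (W t i))).congr_of_eventuallyEq ?_
    filter_upwards [hloc i] with x hx
    rw [hx]
  have hWt := hW t
  simp only [fun i => (hg i).deriv] at hWt
  have hWv := hasDerivAt_pi.2 hWt
  have hCW := (hC (W t)).hasFDerivAt.comp_hasDerivAt t hWv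
  have hsum := HasDerivAt.fun_sum (u := Finset.univ) (fun i _ =>
    (hlam t i).mul ((hg i).comp t (hWt i)))
  refine (hCW.add hsum).congr_deriv ?_
  have hlin : ∀ v : Fin N → ℝ, fderiv ℝ C (W t) v
      = ∑ i, v i * fderiv ℝ C (W t) (Pi.single i 1) := by
    intro v
    have h := LinearMap.pi_apply_eq_sum_univ (fderiv ℝ C (W t)).toLinearMap v
    have hs : ∀ i : Fin N, (fun j => if i = j then (1 : ℝ) else 0) = Pi.single i 1 := by
      intro i
      ext j
      simp [Pi.single_apply, eq_comm]
    simpa [hs] using h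
  rw [hlin, ← Finset.sum_add_distrib,
    ← Finset.sum_add_sum_compl (Finset.univ.filter (fun i => u i (W t i) = 0)), Finset.mul_sum,
    sub_eq_add_neg, ← Finset.sum_neg_distrib]
  congr 1
  · refine Finset.sum_congr rfl fun i hi => ?_
    have h0 : u i (W t i) = 0 := by simpa using hi
    simp only [Function.comp, h0]
    ring
  · refine Finset.sum_congr rfl fun i hi => ?_
    have h0 : u i (W t i) = 1 := (hval i).resolve_left (by simpa using hi)
    simp only [Function.comp, h0]
    ring
end
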